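/- Let n ≥ 2 and let A₁, A₂, B be as in the multiplex construction (B is the combined-layer matrix built from the row-stochastic, symmetric-support layer matrices A₁, A₂, with B irreducible and every strongly connected component of each layer containing an odd closed walk). Then for every integer k ≥ 1, the matrix C = B · A₁^{k−1} is primitive, i.e., there exists m ≥ 1 such that every entry of C^m is strictly positive. -/

import Mathlib

open Matrix

section Support

variable {ι : Type*} [Fintype ι] {M N : Matrix ι ι ℝ}

theorem Matrix.mul_apply_pos_iff (hM : ∀ i j, 0 ≤ M i j) (hN : ∀ i j, 0 ≤ N i j) (i j : ι) :
    0 < (M * N) i j ↔ ∃ l, 0 < M i l ∧ 0 < N l j := by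
  rw [Matrix.mul_apply, Finset.sum_pos_iff_of_nonneg fun l _ => mul_nonneg (hM i l) (hN l j)]
  constructor
  · rintro ⟨l, -, h⟩
    exact ⟨l, (hM i l).lt_of_ne fun h0 => by simp [← h0] at h,
      (hN l j).lt_of_ne fun h0 => by simp [← h0] at h⟩
  · rintro ⟨l, h1, h2⟩
    exact ⟨l, Finset.mem_univ l, mul_pos h1 h2⟩

theorem Matrix.mul_apply_nonneg (hM : ∀ i j, 0 ≤ M i j) (hN : ∀ i j, 0 ≤ N i j) (i j : ι) :
    0 ≤ (M * N) i j := by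
  rw [Matrix.mul_apply]
  exact Finset.sum_nonneg fun l _ => mul_nonneg (hM i l) (hN l j)

variable [DecidableEq ι]

theorem Matrix.pow_apply_nonneg_of_nonneg (hM : ∀ i j, 0 ≤ M i j) (m : ℕ) (i j : ι) :
    0 ≤ (M ^ m) i j := by
  induction m generalizing i j with
  | zero => rw [pow_zero, Matrix.one_apply]; split_ifs <;> norm_num
  | succ m ih => rw [pow_succ]; exact mul_apply_nonneg ih hM i j

theorem Matrix.pow_add_apply_pos (hM : ∀ i j, 0 ≤ M i j) {a b : ℕ} {i l j : ι}
    (h1 : 0 < (M ^ a) i l) (h2 : 0 < (M ^ b) l j) : 0 < (M ^ (a + b)) i j := by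
  rw [pow_add, mul_apply_pos_iff (pow_apply_nonneg_of_nonneg hM a)
    (pow_apply_nonneg_of_nonneg hM b)]
  exact ⟨l, h1, h2⟩

theorem Matrix.pow_apply_self_pos (hM : ∀ i j, 0 ≤ M i j) {i : ι} {a : ℕ}
    (h : 0 < (M ^ a) i i) (m : ℕ) : 0 < (M ^ (a * m)) i i := by
  induction m with
  | zero => simp
  | succ m ih => rw [Nat.mul_succ]; exact pow_add_apply_pos hM ih h

theorem Matrix.pow_apply_pos_symm (hM : ∀ i j, 0 ≤ M i j)
    (hsym : ∀ i j, 0 < M i j ↔ 0 < M j i) (m : ℕ) {i j : ι} (h : 0 < (M ^ m) i j) :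
    0 < (M ^ m) j i := by
  induction m generalizing i j with
  | zero =>
    rw [pow_zero, Matrix.one_apply] at h ⊢
    simpa only [eq_comm] using h
  | succ m ih =>
    rw [pow_succ, mul_apply_pos_iff (pow_apply_nonneg_of_nonneg hM m) hM] at h
    obtain ⟨l, h1, h2⟩ := h
    rw [pow_succ', mul_apply_pos_iff hM (pow_apply_nonneg_of_nonneg hM m)]
    exact ⟨l, (hsym _ _).1 h2, ih h1⟩

theorem Matrix.exists_pow_apply_pos (hM : ∀ i j, 0 ≤ M i j) (hrow : ∀ i, ∑ j, M i j = 1)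
    (m : ℕ) (i : ι) : ∃ j, 0 < (M ^ m) i j := by
  induction m with
  | zero => exact ⟨i, by simp⟩
  | succ m ih =>
    obtain ⟨l, hl⟩ := ih
    obtain ⟨j, -, hj⟩ : ∃ j ∈ Finset.univ, 0 < M l j :=
      (Finset.sum_pos_iff_of_nonneg fun j _ => hM l j).1 (by rw [hrow l]; norm_num)
    refine ⟨j, ?_⟩
    rw [pow_succ, mul_apply_pos_iff (pow_apply_nonneg_of_nonneg hM m) hM]
    exact ⟨l, hl, hj⟩

/-- A vertex of a symmetric support graph that lies on an odd closed walk lies on closed walks of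
all sufficiently large lengths. -/
theorem Matrix.exists_forall_pow_apply_self_pos (hM : ∀ i j, 0 ≤ M i j)
    (hrow : ∀ i, ∑ j, M i j = 1) (hsym : ∀ i j, 0 < M i j ↔ 0 < M j i) {i : ι} {l : ℕ}
    (hl : Odd l) (h : 0 < (M ^ l) i i) : ∃ m₀, ∀ m ≥ m₀, 0 < (M ^ m) i i := by
  obtain ⟨j, hj⟩ := exists_pow_apply_pos hM hrow 1 i
  have h2 : 0 < (M ^ 2) i i :=
    pow_add_apply_pos (a := 1) (b := 1) hM hj (pow_apply_pos_symm hM hsym 1 hj)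
  refine ⟨l, fun m hm => ?_⟩
  rcases Nat.even_or_odd m with ⟨c, hc⟩ | hodd
  · have := pow_apply_self_pos hM h2 c
    rwa [show 2 * c = m by omega] at this
  · obtain ⟨c, hc⟩ : ∃ c, m = l + 2 * c := by
      obtain ⟨a, ha⟩ := hodd
      obtain ⟨b, hb⟩ := hl
      exact ⟨a - b, by omega⟩
    rw [hc]
    exact pow_add_apply_pos hM h (pow_apply_self_pos hM h2 c)

/-- An irreducible nonnegative matrix is primitive as soon as one vertex lies on closed walks of
all sufficiently large lengths. -/
theorem Matrix.exists_pow_pos_of_irreducible (hM : ∀ i j, 0 ≤ M i j)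
    (hirr : ∀ i j, ∃ m, 0 < (M ^ m) i j) {p : ι} {m₀ : ℕ}
    (hp : ∀ m ≥ m₀, 0 < (M ^ m) p p) : ∃ m, 1 ≤ m ∧ ∀ i j, 0 < (M ^ m) i j := by
  choose d hd using hirr
  set D := Finset.univ.sup fun x : ι × ι => d x.1 x.2 with hD
  have hle (i j : ι) : d i j ≤ D :=
    Finset.le_sup (f := fun x : ι × ι => d x.1 x.2) (Finset.mem_univ (i, j))
  refine ⟨m₀ + 2 * D + 1, by omega, fun i j => ?_⟩
  have h1 := hle i p
  have h2 := hle p j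
  have := pow_add_apply_pos hM (pow_add_apply_pos hM (hd i p)
    (hp (m₀ + 2 * D + 1 - d i p - d p j) (by omega))) (hd p j)
  rwa [show d i p + (m₀ + 2 * D + 1 - d i p - d p j) + d p j = m₀ + 2 * D + 1 by omega] at this

/-- A diagonal entry equal to one forces the rest of a row of a stochastic matrix to vanish. -/
theorem Matrix.apply_eq_zero_of_apply_self_eq_one (hM : ∀ i j, 0 ≤ M i j)
    (hrow : ∀ i, ∑ j, M i j = 1) {i j : ι} (hi : M i i = 1) (hij : i ≠ j) : M i j = 0 := by
  have h := Finset.add_sum_erase Finset.univ (fun j => M i j) (Finset.mem_univ i)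
  rw [hrow, hi] at h
  exact (Finset.sum_eq_zero_iff_of_nonneg fun j _ => hM i j).1 (by linarith) j
    (Finset.mem_erase.2 ⟨hij.symm, Finset.mem_univ j⟩)

theorem Matrix.apply_self_ne_one_of_pow_apply_pos (hM : ∀ i j, 0 ≤ M i j)
    (hrow : ∀ i, ∑ j, M i j = 1) (hsym : ∀ i j, 0 < M i j ↔ 0 < M j i) (m : ℕ) {i j : ι}
    (hi : M i i ≠ 1) (h : 0 < (M ^ m) i j) : M j j ≠ 1 := by
  induction m generalizing j with
  | zero =>
    rw [pow_zero, Matrix.one_apply] at h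
    split_ifs at h with hij
    · rwa [← hij]
    · exact absurd h (lt_irrefl 0)
  | succ m ih =>
    rw [pow_succ, mul_apply_pos_iff (pow_apply_nonneg_of_nonneg hM m) hM] at h
    obtain ⟨l, h1, h2⟩ := h
    intro hj
    by_cases hlj : j = l
    · exact ih h1 (hlj ▸ hj)
    · exact ((hsym _ _).1 h2).ne' (apply_eq_zero_of_apply_self_eq_one hM hrow hj hlj)

/-- If `N` dominates the support of `M` on the rows of the non-isolated vertices of `M`, then walks
of `M` of length `(r + 1) * m` from such vertices yield walks of `N * M ^ r` of length `m`. -/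
theorem Matrix.mul_pow_pow_apply_pos (hM : ∀ i j, 0 ≤ M i j) (hN : ∀ i j, 0 ≤ N i j)
    (hrow : ∀ i, ∑ j, M i j = 1) (hsym : ∀ i j, 0 < M i j ↔ 0 < M j i)
    (hMN : ∀ i j, M i i ≠ 1 → 0 < M i j → 0 < N i j) (r m : ℕ) {i j : ι} (hi : M i i ≠ 1)
    (h : 0 < (M ^ ((r + 1) * m)) i j) : 0 < ((N * M ^ r) ^ m) i j := by
  have hMr := pow_apply_nonneg_of_nonneg hM r
  have hC := mul_apply_nonneg hN hMr
  induction m generalizing i with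
  | zero => simpa using h
  | succ m ih =>
    rw [Nat.mul_succ, add_comm, pow_add,
      mul_apply_pos_iff (pow_apply_nonneg_of_nonneg hM _) (pow_apply_nonneg_of_nonneg hM _)] at h
    obtain ⟨l, h1, h2⟩ := h
    rw [pow_succ', mul_apply_pos_iff hC (pow_apply_nonneg_of_nonneg hC m)]
    refine ⟨l, ?_, ih (apply_self_ne_one_of_pow_apply_pos hM hrow hsym _ hi h1) h2⟩
    rw [pow_succ', mul_apply_pos_iff hM hMr] at h1
    obtain ⟨q, hq1, hq2⟩ := h1
    exact (mul_apply_pos_iff hN hMr _ _).2 ⟨q, hMN i q hi hq1, hq2⟩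

end Support

/-- In the multiplex construction, for every integer k ≥ 1 the matrix
`C = B * A₁ ^ (k - 1)` is primitive. -/
theorem multiplex_C_primitive (n : ℕ) (hn : 2 ≤ n)
    (A₁ A₂ B : Matrix (Fin n) (Fin n) ℝ)
    -- A₁, A₂ are row-stochastic
    (hA₁nonneg : ∀ i j, 0 ≤ A₁ i j) (hA₁row : ∀ i, ∑ j, A₁ i j = 1)
    (hA₂nonneg : ∀ i j, 0 ≤ A₂ i j) (hA₂row : ∀ i, ∑ j, A₂ i j = 1)
    -- symmetric support
    (hA₁sym : ∀ i j, 0 < A₁ i j ↔ 0 < A₁ j i)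
    (hA₂sym : ∀ i j, 0 < A₂ i j ↔ 0 < A₂ j i)
    -- every strongly connected component of each layer contains an odd closed walk
    (hA₁odd : ∀ i, ∃ ℓ, 1 ≤ ℓ ∧ Odd ℓ ∧ 0 < (A₁ ^ ℓ) i i)
    (hA₂odd : ∀ i, ∃ ℓ, 1 ≤ ℓ ∧ Odd ℓ ∧ 0 < (A₂ ^ ℓ) i i)
    -- the combined-layer matrix B, defined row-wise
    (hB : ∀ i j, B i j =
      if A₂ i i = 1 then A₁ i j
      else if A₁ i i = 1 then A₂ i j
      else (A₁ i j + A₂ i j) / 2)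
    -- B is irreducible
    (hBirr : ∀ i j, ∃ m, 1 ≤ m ∧ 0 < (B ^ m) i j) :
    -- conclusion: for every k ≥ 1, B * A₁ ^ (k - 1) is primitive
    ∀ k : ℕ, 1 ≤ k → ∃ m, 1 ≤ m ∧ ∀ i j, 0 < ((B * A₁ ^ (k - 1)) ^ m) i j := by
  intro k _
  generalize k - 1 = r
  have hBnonneg (i j : Fin n) : 0 ≤ B i j := by
    have h1 := hA₁nonneg i j
    have h2 := hA₂nonneg i j
    rw [hB]
    split_ifs <;> linarith
  have hAB (i j : Fin n) (hi : A₁ i i ≠ 1) (h : 0 < A₁ i j) : 0 < B i j := by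
    have h2 := hA₂nonneg i j
    rw [hB, if_neg hi]
    split_ifs <;> linarith
  have hA₁r := pow_apply_nonneg_of_nonneg hA₁nonneg r
  have hC := mul_apply_nonneg hBnonneg hA₁r
  have hev (i j : Fin n) (hi : A₁ i i ≠ 1) {a : ℕ} (h : 0 < (A₁ ^ a) i j) :
      ∃ m₀, ∀ m ≥ m₀, 0 < ((B * A₁ ^ r) ^ m) i j := by
    obtain ⟨l, -, hl, hli⟩ := hA₁odd i
    obtain ⟨m₀, hm₀⟩ := exists_forall_pow_apply_self_pos hA₁nonneg hA₁row hA₁sym hl hli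
    refine ⟨m₀ + a, fun m hm => ?_⟩
    have hmr : m ≤ (r + 1) * m := Nat.le_mul_of_pos_left m r.succ_pos
    refine mul_pow_pow_apply_pos hA₁nonneg hBnonneg hA₁row hA₁sym hAB r m hi ?_
    have := pow_add_apply_pos hA₁nonneg (hm₀ ((r + 1) * m - a) (by omega)) h
    rwa [Nat.sub_add_cancel (by omega)] at this
  have hedge (i j : Fin n) (h : 0 < B i j) : ∃ m, 0 < ((B * A₁ ^ r) ^ m) i j := by
    by_cases hj : A₁ j j = 1
    · refine ⟨1, ?_⟩
      rw [pow_one, mul_apply_pos_iff hBnonneg hA₁r]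
      refine ⟨j, h, ?_⟩
      have h1 : 0 < (A₁ ^ 1) j j := by rw [pow_one, hj]; norm_num
      simpa using pow_apply_self_pos hA₁nonneg h1 r
    · obtain ⟨q, hq⟩ := exists_pow_apply_pos hA₁nonneg hA₁row r j
      have hq1 := apply_self_ne_one_of_pow_apply_pos hA₁nonneg hA₁row hA₁sym r hj hq
      obtain ⟨m, hm⟩ := hev q j hq1 (pow_apply_pos_symm hA₁nonneg hA₁sym r hq)
      have hiq : 0 < ((B * A₁ ^ r) ^ 1) i q := by
        rw [pow_one, mul_apply_pos_iff hBnonneg hA₁r]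
        exact ⟨j, h, hq⟩
      exact ⟨1 + m, pow_add_apply_pos hC hiq (hm m le_rfl)⟩
  have hirr (i j : Fin n) : ∃ m, 0 < ((B * A₁ ^ r) ^ m) i j := by
    obtain ⟨m, -, hm⟩ := hBirr i j
    induction m generalizing j with
    | zero => exact ⟨0, by simpa using hm⟩
    | succ m ih =>
      rw [pow_succ, mul_apply_pos_iff (pow_apply_nonneg_of_nonneg hBnonneg m) hBnonneg] at hm
      obtain ⟨l, h1, h2⟩ := hm
      obtain ⟨a, ha⟩ := ih l h1
      obtain ⟨b, hb⟩ := hedge l j h2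
      exact ⟨a + b, pow_add_apply_pos hC ha hb⟩
  by_cases hiso : ∃ i, A₁ i i ≠ 1
  · obtain ⟨i, hi⟩ := hiso
    obtain ⟨m₀, hm₀⟩ := hev i i hi (a := 0) (by simp)
    exact exists_pow_pos_of_irreducible hC hirr hm₀
  · push Not at hiso
    have hone : A₁ = 1 := by
      ext i j
      by_cases hij : i = j
      · rw [← hij, hiso, Matrix.one_apply_eq]
      · rw [apply_eq_zero_of_apply_self_eq_one hA₁nonneg hA₁row (hiso i) hij,
          Matrix.one_apply_ne hij]
    have hBA : B = A₂ := by
      ext i j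
      rw [hB, if_pos (hiso i)]
      split_ifs with h2
      · by_cases hij : i = j
        · rw [← hij, hiso, h2]
        · rw [apply_eq_zero_of_apply_self_eq_one hA₁nonneg hA₁row (hiso i) hij,
            apply_eq_zero_of_apply_self_eq_one hA₂nonneg hA₂row h2 hij]
      · rfl
    have hCA : B * A₁ ^ r = A₂ := by rw [hone, one_pow, mul_one, hBA]
    rw [hCA] at hC hirr ⊢
    obtain ⟨l, -, hl, hli⟩ := hA₂odd ⟨0, by omega⟩
    obtain ⟨m₀, hm₀⟩ := exists_forall_pow_apply_self_pos hA₂nonneg hA₂row hA₂sym hl hli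
    exact exists_pow_pos_of_irreducible hC hirr hm₀
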